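/- Let r be a natural number with r ≥ 4/ε⁵. If there exists a degree-r SA pseudoexpectation for the system order(B,T), then there exists an integral solution of order(B,(1+ε)T); in particular, there exists an assignment σ : J → [m] whose makespan max_{i∈[m]} Σ_{j:σ(j)=i} p_j is at most (1+ε)T. -/

import Mathlib

open MvPolynomial Finset

set_option synthInstance.maxHeartbeats 400000
noncomputable section
open scoped Classical

/-- The ideal `I_E` generated by `x_e^2 - x_e` for `e ∈ E`. -/
def cubeIdeal (E : Type*) : Ideal (MvPolynomial E ℝ) :=
  Ideal.span (Set.range fun e : E => (X e : MvPolynomial E ℝ) ^ 2 - X e)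

/-- The quotient ring `ℝ[x]/I_E`. -/
abbrev CubeQuot (E : Type*) := MvPolynomial E ℝ ⧸ cubeIdeal E

def mkC {E : Type*} : MvPolynomial E ℝ →+* CubeQuot E :=
  Ideal.Quotient.mk (cubeIdeal E)

/-- Degree of an element of `ℝ[x]/I_E` (degree of its square-free representative,
i.e. minimal total degree among representatives). -/
def qdeg {E : Type*} (a : CubeQuot E) : ℕ :=
  sInf (MvPolynomial.totalDegree '' {f : MvPolynomial E ℝ | mkC f = a})

/-- `φ_{S,R} = ∏_{e∈S} x_e · ∏_{e∈R} (1 − x_e)`. -/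
def phiSR {E : Type*} (S R : Finset E) : MvPolynomial E ℝ :=
  (∏ e ∈ S, X e) * ∏ e ∈ R, (1 - X e)

/-- A degree-`r` Sherali–Adams pseudoexpectation for the system of linear constraints
`{g ≥ 0 (g ∈ G), h = 0 (h ∈ H)}` over 0/1 variables indexed by `E`. -/
def IsSAPseudo {E : Type*} (G H : Set (MvPolynomial E ℝ)) (r : ℕ)
    (PE : CubeQuot E →ₗ[ℝ] ℝ) : Prop :=
  PE 1 = 1 ∧
  (∀ S R : Finset E, Disjoint S R → S.card + R.card ≤ r → 0 ≤ PE (mkC (phiSR S R))) ∧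
  (∀ g ∈ G, ∀ S R : Finset E, Disjoint S R → qdeg (mkC (phiSR S R * g)) ≤ r →
    0 ≤ PE (mkC (phiSR S R * g))) ∧
  (∀ h ∈ H, ∀ S R : Finset E, Disjoint S R → qdeg (mkC (phiSR S R * h)) ≤ r →
    PE (mkC (phiSR S R * h)) = 0)

/-- The class `J_q` of long jobs whose processing time lies in
`[(1/ε + q − 1)·ε²T, (1/ε + q)·ε²T)`. -/
def Jq {ι : Type*} [Fintype ι] (p : ι → ℝ) (ε T : ℝ) (q : ℕ) : Finset ι :=
  Finset.univ.filter fun j =>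
    (1 / ε + (q : ℝ) - 1) * ε ^ 2 * T ≤ p j ∧ p j < (1 / ε + (q : ℝ)) * ε ^ 2 * T

/-- The equality constraints: `Σ_{i∈[m]} x_{ij} − 1 = 0` for each job `j`. -/
def assignEqs (m : ℕ) (ι : Type*) [Fintype ι] : Set (MvPolynomial (ℕ × ι) ℝ) :=
  Set.range fun j : ι => (∑ i ∈ Finset.Icc 1 m, (X (i, j) : MvPolynomial (ℕ × ι) ℝ)) - 1

/-- The inequality constraints of `order(B,T)`: load constraints, symmetry-breaking
constraints, ordering constraints, and nonnegativity of the variables. -/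
def orderIneqs {ι : Type*} [Fintype ι] (m s : ℕ) (p : ι → ℝ) (ε T : ℝ) (B : ℕ)
    (jenum : ℕ → ℕ → ι) : Set (MvPolynomial (ℕ × ι) ℝ) :=
  ((fun i : ℕ => MvPolynomial.C T - ∑ j : ι, MvPolynomial.C (p j) * X (i, j)) ''
      ↑(Finset.Icc 1 m)) ∪
  ((fun i : ℕ => ∑ q ∈ Finset.Icc 1 s,
        MvPolynomial.C ((B : ℝ) ^ (s - q)) *
          ∑ j ∈ Jq p ε T q, ((X (i, j) : MvPolynomial (ℕ × ι) ℝ) - X (i + 1, j))) ''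
      ↑(Finset.Icc 1 (m - 1))) ∪
  {f | ∃ q ∈ Finset.Icc 1 s, ∃ ℓ ∈ Finset.Icc 1 ((Jq p ε T q).card - 1),
    ∃ h ∈ Finset.Icc 1 m,
      f = (∑ i ∈ Finset.Icc 1 h, (X (i, jenum q ℓ) : MvPolynomial (ℕ × ι) ℝ)) -
            ∑ i ∈ Finset.Icc 1 h, X (i, jenum q (ℓ + 1))} ∪
  {f | ∃ i ∈ Finset.Icc 1 m, ∃ j : ι, f = X (i, j)}

/-- Local facts extracted from the pseudoexpectation. -/
structure Loc {ι : Type*} [Fintype ι] (m s r : ℕ) (p : ι → ℝ) (T : ℝ) (B : ℕ)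
    (J : ℕ → Finset ι) (jenum : ℕ → ℕ → ι) (P : Finset (ℕ × ι) → ℝ) : Prop where
  one : P ∅ = 1
  nn : ∀ S, S.card ≤ r → 0 ≤ P S
  asg : ∀ S, S.card < r → ∀ j, ∑ i ∈ Finset.Icc 1 m, P (insert (i, j) S) = P S
  load : ∀ S, S.card < r → ∀ i ∈ Finset.Icc 1 m, ∑ j, p j * P (insert (i, j) S) ≤ T * P S
  sym : ∀ S, S.card < r → ∀ i ∈ Finset.Icc 1 (m - 1),
    0 ≤ ∑ q ∈ Finset.Icc 1 s, (B : ℝ) ^ (s - q) *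
      ∑ j ∈ J q, (P (insert (i, j) S) - P (insert (i + 1, j) S))
  ord : ∀ S, S.card < r → ∀ q ∈ Finset.Icc 1 s, ∀ ℓ ∈ Finset.Icc 1 ((J q).card - 1),
    ∀ h ∈ Finset.Icc 1 m,
      ∑ i ∈ Finset.Icc 1 h, P (insert (i, jenum q (ℓ + 1)) S) ≤
        ∑ i ∈ Finset.Icc 1 h, P (insert (i, jenum q ℓ) S)

def monoVal {E : Type*} (PE : CubeQuot E →ₗ[ℝ] ℝ) (S : Finset E) : ℝ :=
  PE (mkC (∏ e ∈ S, X e))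

def polyVal {E : Type*} (PE : CubeQuot E →ₗ[ℝ] ℝ) : MvPolynomial E ℝ →ₗ[ℝ] ℝ :=
  PE ∘ₗ (Ideal.Quotient.mkₐ ℝ (cubeIdeal E)).toLinearMap

lemma polyVal_apply {E : Type*} (PE : CubeQuot E →ₗ[ℝ] ℝ) (f : MvPolynomial E ℝ) :
    polyVal PE f = PE (mkC f) := rfl

lemma polyVal_C_mul {E : Type*} (PE : CubeQuot E →ₗ[ℝ] ℝ) (c : ℝ) (f : MvPolynomial E ℝ) :
    polyVal PE (C c * f) = c * polyVal PE f := by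
  rw [← MvPolynomial.smul_eq_C_mul, map_smul, smul_eq_mul]

lemma phiSR_empty {E : Type*} (S : Finset E) : phiSR S ∅ = ∏ e ∈ S, X e := by
  simp [phiSR]

lemma polyVal_phi_X {E : Type*} [DecidableEq E] (PE : CubeQuot E →ₗ[ℝ] ℝ) (S : Finset E) (e : E) :
    polyVal PE (phiSR S ∅ * X e) = monoVal PE (insert e S) := by
  rw [phiSR_empty, monoVal, polyVal_apply]
  congr 1
  by_cases h : e ∈ S
  · rw [Finset.insert_eq_of_mem h, ← Finset.mul_prod_erase S _ h]
    refine Ideal.Quotient.eq.2 ?_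
    have : X e * (∏ x ∈ S.erase e, X x) * X e - X e * ∏ x ∈ S.erase e, X x
      = (∏ x ∈ S.erase e, X x) * ((X e : MvPolynomial E ℝ) ^ 2 - X e) := by ring
    rw [this]
    exact Ideal.mul_mem_left _ _ (Ideal.subset_span ⟨e, rfl⟩)
  · rw [Finset.prod_insert h, mul_comm]

lemma qdeg_le {E : Type*} (f : MvPolynomial E ℝ) : qdeg (mkC f) ≤ f.totalDegree :=
  Nat.sInf_le ⟨f, rfl, rfl⟩

lemma qdeg_phi_mul_le {E : Type*} (S : Finset E) (g : MvPolynomial E ℝ) (hg : g.totalDegree ≤ 1)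
    {r : ℕ} (hS : S.card < r) : qdeg (mkC (phiSR S ∅ * g)) ≤ r := by
  refine (qdeg_le _).trans ((totalDegree_mul _ _).trans ?_)
  have : (phiSR S ∅ : MvPolynomial E ℝ).totalDegree ≤ S.card := by
    rw [phiSR_empty]
    refine (totalDegree_finsetProd _ _).trans ?_
    simp [totalDegree_X]
  omega

lemma deg_X_le {E : Type*} (e : E) : (X e : MvPolynomial E ℝ).totalDegree ≤ 1 := by
  simp

lemma deg_sub_le {E : Type*} {f g : MvPolynomial E ℝ} (hf : f.totalDegree ≤ 1)
    (hg : g.totalDegree ≤ 1) : (f - g).totalDegree ≤ 1 :=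
  (totalDegree_sub _ _).trans (max_le hf hg)

lemma deg_sum_le {E α : Type*} (s : Finset α) (f : α → MvPolynomial E ℝ)
    (hf : ∀ a ∈ s, (f a).totalDegree ≤ 1) : (∑ a ∈ s, f a).totalDegree ≤ 1 :=
  totalDegree_finsetSum_le hf

lemma deg_C_mul_le {E : Type*} (c : ℝ) {f : MvPolynomial E ℝ} (hf : f.totalDegree ≤ 1) :
    (C c * f).totalDegree ≤ 1 :=
  (totalDegree_mul _ _).trans (by simpa using hf)

lemma loc_of_SA {ι : Type*} [Fintype ι] {m s r : ℕ} {p : ι → ℝ} {ε T : ℝ} {B : ℕ}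
    {jenum : ℕ → ℕ → ι} {PE : CubeQuot (ℕ × ι) →ₗ[ℝ] ℝ}
    (h : IsSAPseudo (orderIneqs m s p ε T B jenum) (assignEqs m ι) r PE) :
    Loc m s r p T B (Jq p ε T) jenum (monoVal PE) := by
  obtain ⟨h1, h2, h3, h4⟩ := h
  have hphi : ∀ S : Finset (ℕ × ι), polyVal PE (phiSR S ∅) = monoVal PE S := by
    intro S; rw [phiSR_empty]; rfl
  have h3' : ∀ g ∈ orderIneqs m s p ε T B jenum, g.totalDegree ≤ 1 → ∀ S : Finset (ℕ × ι),
      S.card < r → 0 ≤ polyVal PE (phiSR S ∅ * g) := fun g hg hd S hS =>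
    h3 g hg S ∅ (Finset.disjoint_empty_right _) (qdeg_phi_mul_le S g hd hS)
  refine ⟨?_, ?_, ?_, ?_, ?_, ?_⟩
  · simpa [monoVal] using h1
  · intro S hS
    have := h2 S ∅ (Finset.disjoint_empty_right _) (by simpa using hS)
    rwa [phiSR_empty] at this
  · intro S hS j
    have := h4 _ ⟨j, rfl⟩ S ∅ (Finset.disjoint_empty_right _) (qdeg_phi_mul_le S _
      (deg_sub_le (deg_sum_le _ _ fun _ _ => deg_X_le _) (by simp)) hS)
    rw [← polyVal_apply, mul_sub, mul_one, map_sub, Finset.mul_sum, map_sum, hphi] at this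
    simp only [polyVal_phi_X] at this
    linarith
  · intro S hS i hi
    have := h3' _ (Or.inl (Or.inl (Or.inl ⟨i, hi, rfl⟩))) (deg_sub_le (by simp)
      (deg_sum_le _ _ fun _ _ => deg_C_mul_le _ (deg_X_le _))) S hS
    simp only [mul_sub, map_sub, Finset.mul_sum, map_sum, mul_left_comm _ (C _) _,
      polyVal_C_mul, polyVal_phi_X] at this
    rw [mul_comm, polyVal_C_mul, hphi] at this
    linarith
  · intro S hS i hi
    have := h3' _ (Or.inl (Or.inl (Or.inr ⟨i, hi, rfl⟩))) (deg_sum_le _ _ fun _ _ =>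
      deg_C_mul_le _ (deg_sum_le _ _ fun _ _ => deg_sub_le (deg_X_le _) (deg_X_le _))) S hS
    rw [Finset.mul_sum, map_sum] at this
    refine this.trans_eq (Finset.sum_congr rfl fun q _ => ?_)
    rw [mul_left_comm, polyVal_C_mul, Finset.mul_sum, map_sum]
    congr 1
    refine Finset.sum_congr rfl fun j _ => ?_
    rw [mul_sub, map_sub, polyVal_phi_X, polyVal_phi_X]
  · intro S hS q hq ℓ hℓ h hh
    have := h3' _ (Or.inl (Or.inr ⟨q, hq, ℓ, hℓ, h, hh, rfl⟩)) (deg_sub_le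
      (deg_sum_le _ _ fun _ _ => deg_X_le _) (deg_sum_le _ _ fun _ _ => deg_X_le _)) S hS
    rw [mul_sub, map_sub, Finset.mul_sum, Finset.mul_sum, map_sum, map_sum] at this
    simp only [polyVal_phi_X] at this
    linarith

section locsec

set_option linter.unusedSectionVars false

variable {ι : Type*} [Fintype ι] {m s r : ℕ} {p : ι → ℝ} {T : ℝ} {B : ℕ}
  {J : ℕ → Finset ι} {jenum : ℕ → ℕ → ι} {P : Finset (ℕ × ι) → ℝ}

def Valid (m : ℕ) (S : Finset (ℕ × ι)) : Prop := ∀ e ∈ S, e.1 ∈ Finset.Icc 1 m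

lemma card_ins (e : ℕ × ι) (S : Finset (ℕ × ι)) : (insert e S).card ≤ S.card + 1 :=
  Finset.card_insert_le _ _

lemma Valid.insert {S : Finset (ℕ × ι)} (h : Valid m S) {i : ℕ} (hi : i ∈ Finset.Icc 1 m)
    (j : ι) : Valid m (insert (i, j) S) := by
  intro e he
  rcases Finset.mem_insert.1 he with rfl | he
  · exact hi
  · exact h e he

lemma Valid.union {S S' : Finset (ℕ × ι)} (h : Valid m S) (h' : Valid m S') :
    Valid m (S ∪ S') := by
  intro e he
  rcases Finset.mem_union.1 he with he | he
  · exact h e he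
  · exact h' e he

lemma Loc.insert_le (L : Loc m s r p T B J jenum P) {S : Finset (ℕ × ι)} (hS : S.card < r)
    {i : ℕ} (hi : i ∈ Finset.Icc 1 m) (j : ι) : P (insert (i, j) S) ≤ P S := by
  rw [← L.asg S hS j]
  exact Finset.single_le_sum (f := fun i => P (insert (i, j) S))
    (fun i _ => L.nn _ ((card_ins _ _).trans hS)) hi

lemma Loc.mono (L : Loc m s r p T B J jenum P) {S' : Finset (ℕ × ι)} (D : Finset (ℕ × ι)) :
    Valid m D → (S' ∪ D).card ≤ r → P (S' ∪ D) ≤ P S' := by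
  induction D using Finset.induction_on with
  | empty => simp
  | insert e D he ih =>
    intro hv hc
    by_cases h : e ∈ S' ∪ D
    · rw [Finset.union_insert, Finset.insert_eq_of_mem h] at *
      exact ih (fun x hx => hv x (Finset.mem_insert_of_mem hx)) hc
    · rw [Finset.union_insert] at *
      rw [Finset.card_insert_of_notMem h] at hc
      refine (L.insert_le (by omega) (hv e (Finset.mem_insert_self _ _)) e.2).trans
        (ih (fun x hx => hv x (Finset.mem_insert_of_mem hx)) (by omega))

lemma Loc.pos_subset (L : Loc m s r p T B J jenum P) {S' S : Finset (ℕ × ι)} (hv : Valid m S)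
    (hc : S.card ≤ r) (hs : S' ⊆ S) (h : 0 < P S) : 0 < P S' := by
  have := L.mono (S' := S') S hv (by rwa [Finset.union_eq_right.2 hs])
  rw [Finset.union_eq_right.2 hs] at this
  linarith

lemma Loc.ext (L : Loc m s r p T B J jenum P) {S : Finset (ℕ × ι)} (hS : S.card < r)
    (h : 0 < P S) (j : ι) : ∃ i ∈ Finset.Icc 1 m, 0 < P (insert (i, j) S) := by
  rw [← L.asg S hS j] at h
  exact Finset.exists_lt_of_sum_lt (f := fun _ => (0 : ℝ)) (by simpa using h)

lemma Loc.func (L : Loc m s r p T B J jenum P) {S : Finset (ℕ × ι)} (hv : Valid m S)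
    (hS : S.card < r) (h : 0 < P S) {i i' : ℕ} {j : ι} (h1 : (i, j) ∈ S) (h2 : (i', j) ∈ S) :
    i = i' := by
  by_contra hne
  have := L.asg S hS j
  have h3 : ∑ a ∈ {i, i'}, P (insert (a, j) S) ≤ ∑ i ∈ Finset.Icc 1 m, P (insert (i, j) S) := by
    refine Finset.sum_le_sum_of_subset_of_nonneg ?_ fun i _ _ =>
      L.nn _ ((card_ins _ _).trans hS)
    intro a ha
    rcases Finset.mem_insert.1 ha with rfl | ha
    · exact hv _ h1
    · rw [Finset.mem_singleton.1 ha]; exact hv _ h2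
  rw [Finset.sum_pair hne, Finset.insert_eq_of_mem h1, Finset.insert_eq_of_mem h2] at h3
  linarith

lemma Loc.ord' (L : Loc m s r p T B J jenum P) {S : Finset (ℕ × ι)} (hS : S.card < r)
    {q : ℕ} (hq : q ∈ Finset.Icc 1 s) {h : ℕ} (hh : h ∈ Finset.Icc 1 m) {ℓ : ℕ} (h1 : 1 ≤ ℓ)
    (d : ℕ) : ℓ + d ≤ (J q).card →
      ∑ i ∈ Finset.Icc 1 h, P (insert (i, jenum q (ℓ + d)) S) ≤
        ∑ i ∈ Finset.Icc 1 h, P (insert (i, jenum q ℓ) S) := by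
  induction d with
  | zero => intro _; exact le_rfl
  | succ d ih =>
    intro hd
    exact (L.ord S hS q hq (ℓ + d) (Finset.mem_Icc.2 ⟨by omega, by omega⟩) h hh).trans
      (ih (by omega))

lemma Loc.order (L : Loc m s r p T B J jenum P) {S : Finset (ℕ × ι)} (hv : Valid m S)
    (hS : S.card + 1 < r) (h : 0 < P S) {q : ℕ} (hq : q ∈ Finset.Icc 1 s) {ℓ ℓ' : ℕ}
    (h1 : 1 ≤ ℓ) (h2 : ℓ ≤ ℓ') (h3 : ℓ' ≤ (J q).card) {i i' : ℕ}
    (hi : (i, jenum q ℓ) ∈ S) (hi' : (i', jenum q ℓ') ∈ S) : i ≤ i' := by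
  by_contra! hlt
  obtain ⟨d, rfl⟩ := Nat.exists_eq_add_of_le h2
  have hm := hv _ hi'
  have key := L.ord' (by omega : S.card < r) hq hm h1 d h3
  have e0 : ∑ a ∈ Finset.Icc 1 i', P (insert (a, jenum q ℓ) S) = 0 := by
    refine Finset.sum_eq_zero fun a ha => ?_
    by_contra hne
    have ha' : a ∈ Finset.Icc 1 m := by
      simp only [Finset.mem_Icc] at *; omega
    have hc := card_ins (a, jenum q ℓ) S
    have hp : 0 < P (insert (a, jenum q ℓ) S) :=
      lt_of_le_of_ne (L.nn _ (by omega)) (Ne.symm hne)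
    have := L.func (hv.insert ha' _) (by omega) hp (Finset.mem_insert_self _ _)
      (Finset.mem_insert_of_mem hi)
    simp only [Finset.mem_Icc] at *; omega
  have e1 : P S ≤ ∑ a ∈ Finset.Icc 1 i', P (insert (a, jenum q (ℓ + d)) S) := by
    have := Finset.single_le_sum (s := Finset.Icc 1 i')
      (f := fun a => P (insert (a, jenum q (ℓ + d)) S)) (a := i')
      (fun a _ => L.nn _ (by have := card_ins (a, jenum q (ℓ + d)) S; omega))
      (by simp only [Finset.mem_Icc] at *; omega)
    simpa only [Finset.insert_eq_of_mem hi'] using this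
  linarith

/-- `S` certifies that exactly `n q` jobs of class `q` lie on the first `h` machines. -/
def Cut1 (m : ℕ) (J : ℕ → Finset ι) (jenum : ℕ → ℕ → ι) (S : Finset (ℕ × ι)) (h q n : ℕ) : Prop :=
  n ≤ (J q).card ∧ (n = 0 ∨ ∃ i ∈ Finset.Icc 1 m, i ≤ h ∧ (i, jenum q n) ∈ S) ∧
    (n = (J q).card ∨ ∃ i ∈ Finset.Icc 1 m, h < i ∧ (i, jenum q (n + 1)) ∈ S)

lemma Cut1.mono {S S' : Finset (ℕ × ι)} {h q n : ℕ} (hc : Cut1 m J jenum S h q n) (hs : S ⊆ S') :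
    Cut1 m J jenum S' h q n := by
  obtain ⟨a, b, c⟩ := hc
  refine ⟨a, b.imp_right ?_, c.imp_right ?_⟩
  · rintro ⟨i, hi, hh, hS⟩; exact ⟨i, hi, hh, hs hS⟩
  · rintro ⟨i, hi, hh, hS⟩; exact ⟨i, hi, hh, hs hS⟩

lemma Loc.cut1_ext (L : Loc m s r p T B J jenum P) {S : Finset (ℕ × ι)} (hv : Valid m S)
    (hS : S.card + 4 < r) (h : 0 < P S) (q k : ℕ) :
    ∃ n D, D.card ≤ 2 ∧ Valid m D ∧ 0 < P (S ∪ D) ∧ Cut1 m J jenum D k q n := by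
  let Q : ℕ → Prop := fun n => n = 0 ∨ ∃ i ∈ Finset.Icc 1 m, i ≤ k ∧ 0 < P (insert (i, jenum q n) S)
  set n := Nat.findGreatest Q (J q).card with hn
  have hQn : Q n := Nat.findGreatest_spec (P := Q) (Nat.zero_le _) (Or.inl rfl)
  have hle : n ≤ (J q).card := Nat.findGreatest_le _
  have hmax : ∀ n', n < n' → n' ≤ (J q).card → ¬ Q n' := fun n' h1 h2 =>
    Nat.findGreatest_is_greatest h1 h2
  clear_value n
  obtain ⟨D1, hD1, hv1, hp1, hc1⟩ : ∃ D1 : Finset (ℕ × ι), D1.card ≤ 1 ∧ Valid m D1 ∧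
      0 < P (S ∪ D1) ∧ (n = 0 ∨ ∃ i ∈ Finset.Icc 1 m, i ≤ k ∧ (i, jenum q n) ∈ D1) := by
    rcases hQn with h0 | ⟨i, hi, hik, hp⟩
    · exact ⟨∅, by simp, by intro e he; simp at he, by simpa using h, Or.inl h0⟩
    · refine ⟨{(i, jenum q n)}, by simp, ?_, ?_, Or.inr ⟨i, hi, hik, by simp⟩⟩
      · intro e he; rw [Finset.mem_singleton.1 he]; exact hi
      · rwa [Finset.union_comm, ← Finset.insert_eq]
  rcases Nat.eq_or_lt_of_le hle with heq | hlt
  · exact ⟨n, D1, by omega, hv1, hp1, hle, hc1, Or.inl heq⟩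
  · have hcu := Finset.card_union_le S D1
    obtain ⟨i, hi, hpi⟩ := L.ext (S := S ∪ D1) (by omega) hp1 (jenum q (n + 1))
    refine ⟨n, insert (i, jenum q (n + 1)) D1, ?_, hv1.insert hi _, ?_, hle, ?_, Or.inr ⟨i, hi, ?_, ?_⟩⟩
    · have := card_ins (i, jenum q (n + 1)) D1; omega
    · rwa [Finset.union_insert]
    · refine hc1.imp_right ?_
      rintro ⟨i, hi, hh, hS⟩; exact ⟨i, hi, hh, Finset.mem_insert_of_mem hS⟩
    · by_contra! hik
      refine hmax (n + 1) (by omega) hlt (Or.inr ⟨i, hi, hik, ?_⟩)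
      refine L.pos_subset ((hv.union hv1).insert hi _) ?_ ?_ hpi
      · have := card_ins (i, jenum q (n + 1)) (S ∪ D1); omega
      · exact Finset.insert_subset_insert _ Finset.subset_union_left
    · exact Finset.mem_insert_self _ _

lemma Loc.cut_ext (L : Loc m s r p T B J jenum P) {S : Finset (ℕ × ι)} (hv : Valid m S)
    (h : 0 < P S) (k : ℕ) (Q : Finset ℕ) : S.card + 2 * Q.card + 4 < r →
    ∃ (n : ℕ → ℕ) (D : Finset (ℕ × ι)), D.card ≤ 2 * Q.card ∧ Valid m D ∧ 0 < P (S ∪ D) ∧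
      ∀ q ∈ Q, Cut1 m J jenum D k q (n q) := by
  induction Q using Finset.induction_on with
  | empty =>
    intro _
    exact ⟨fun _ => 0, ∅, by simp, by intro e he; simp at he, by simpa using h, by simp⟩
  | insert q Q hq ih =>
    intro hc
    rw [Finset.card_insert_of_notMem hq] at hc ⊢
    obtain ⟨n, D, hD, hvD, hp, hcut⟩ := ih (by omega)
    have hcu := Finset.card_union_le S D
    obtain ⟨n', D', hD', hvD', hp', hcut'⟩ := L.cut1_ext (hv.union hvD) (by omega) hp q k
    refine ⟨Function.update n q n', D ∪ D', ?_, hvD.union hvD', ?_, ?_⟩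
    · have := Finset.card_union_le D D'; omega
    · rwa [← Finset.union_assoc]
    · intro q' hq'
      rcases Finset.mem_insert.1 hq' with rfl | hq''
      · rw [Function.update_self]; exact hcut'.mono Finset.subset_union_right
      · rw [Function.update_of_ne (by rintro rfl; exact hq hq'')]
        exact (hcut q' hq'').mono Finset.subset_union_left

end locsec

lemma chain_exists {α : Type*} (Good : ℕ → α → α → Prop) (R : ℕ → α → α → α → Prop) (a b : α)
    (h0 : Good 0 a b)
    (step : ∀ h a b, Good h a b → ∃ c, Good (h + 1) b c ∧ R h a b c) :
    ∃ f : ℕ → α, ∀ h, R h (f h) (f (h + 1)) (f (h + 2)) := by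
  choose F hF using step
  let g : ∀ h : ℕ, {x : α × α // Good h x.1 x.2} := fun h => Nat.rec ⟨(a, b), h0⟩
    (fun h x => ⟨(x.1.2, F h x.1.1 x.1.2 x.2), (hF h x.1.1 x.1.2 x.2).1⟩) h
  exact ⟨fun h => (g h).1.1, fun h => (hF h (g h).1.1 (g h).1.2 (g h).2).2⟩

section locsec2

set_option linter.unusedSectionVars false

variable {ι : Type*} [Fintype ι] {m s r : ℕ} {p : ι → ℝ} {T : ℝ} {B : ℕ}
  {J : ℕ → Finset ι} {jenum : ℕ → ℕ → ι} {P : Finset (ℕ × ι) → ℝ}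

lemma Loc.chain (L : Loc m s r p T B J jenum P) (hr : 6 * s + 10 ≤ r) {K : Finset (ℕ × ι)}
    (hvK : Valid m K) (hcK : K.card ≤ 1) (hpK : 0 < P K) :
    ∃ (n : ℕ → ℕ → ℕ) (S : ℕ → Finset (ℕ × ι)), ∀ h, K ⊆ S h ∧ Valid m (S h) ∧
      (S h).card ≤ 6 * s + 1 ∧ 0 < P (S h) ∧ ∀ q ∈ Finset.Icc 1 s,
        Cut1 m J jenum (S h) h q (n h q) ∧ Cut1 m J jenum (S h) (h + 1) q (n (h + 1) q) ∧
        Cut1 m J jenum (S h) (h + 2) q (n (h + 2) q) := by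
  let C : ℕ → (Finset (ℕ × ι) × (ℕ → ℕ)) → Prop := fun h x =>
    x.1.card ≤ 2 * s ∧ Valid m x.1 ∧ ∀ q ∈ Finset.Icc 1 s, Cut1 m J jenum x.1 h q (x.2 q)
  have hext : ∀ S : Finset (ℕ × ι), Valid m S → S.card ≤ 4 * s + 1 → 0 < P S → ∀ h,
      ∃ x, C h x ∧ 0 < P (S ∪ x.1) := by
    intro S hv hc hp h
    obtain ⟨n, D, h1, h2, h3, h4⟩ := L.cut_ext hv hp h (Finset.Icc 1 s)
      (by rw [Nat.card_Icc]; omega)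
    exact ⟨(D, n), ⟨by simpa using h1, h2, h4⟩, h3⟩
  obtain ⟨a, ha, hpa⟩ := hext K hvK (by omega) hpK 0
  have hcKa := Finset.card_union_le K a.1
  have hca := ha.1
  obtain ⟨b, hb, hpb⟩ := hext (K ∪ a.1) (hvK.union ha.2.1) (by omega) hpa 1
  obtain ⟨f, hf⟩ := chain_exists
    (fun h a b => C h a ∧ C (h + 1) b ∧ 0 < P (K ∪ a.1 ∪ b.1))
    (fun h a b c => C h a ∧ C (h + 1) b ∧ C (h + 2) c ∧ 0 < P (K ∪ a.1 ∪ b.1 ∪ c.1))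
    a b ⟨ha, hb, hpb⟩ (by
      rintro h a b ⟨ha, hb, hp⟩
      have h1 := Finset.card_union_le K a.1
      have h2 := Finset.card_union_le (K ∪ a.1) b.1
      have hca := ha.1
      have hcb := hb.1
      have hv := (hvK.union ha.2.1).union hb.2.1
      obtain ⟨c, hc, hpc⟩ := hext _ hv (by omega) hp (h + 2)
      have hcc := hc.1
      have h3 := Finset.card_union_le (K ∪ a.1 ∪ b.1) c.1
      refine ⟨c, ⟨hb, hc, ?_⟩, ha, hb, hc, hpc⟩
      refine L.pos_subset (hv.union hc.2.1) (by omega) ?_ hpc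
      intro e he
      simp only [Finset.mem_union] at he ⊢
      tauto)
  refine ⟨fun h => (f h).2, fun h => K ∪ (f h).1 ∪ (f (h + 1)).1 ∪ (f (h + 2)).1, fun h => ?_⟩
  obtain ⟨ha, hb, hc, hp⟩ := hf h
  refine ⟨?_, ((hvK.union ha.2.1).union hb.2.1).union hc.2.1, ?_, hp, fun q hq => ⟨?_, ?_, ?_⟩⟩
  · intro e he; simp only [Finset.mem_union]; tauto
  · have h1 := Finset.card_union_le K (f h).1
    have h2 := Finset.card_union_le (K ∪ (f h).1) (f (h + 1)).1
    have h3 := Finset.card_union_le (K ∪ (f h).1 ∪ (f (h + 1)).1) (f (h + 2)).1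
    have hca := ha.1
    have hcb := hb.1
    have hcc := hc.1
    show (K ∪ (f h).1 ∪ (f (h + 1)).1 ∪ (f (h + 2)).1).card ≤ 6 * s + 1
    omega
  · refine (ha.2.2 q hq).mono ?_
    intro e he; simp only [Finset.mem_union]; tauto
  · refine (hb.2.2 q hq).mono ?_
    intro e he; simp only [Finset.mem_union]; tauto
  · refine (hc.2.2 q hq).mono ?_
    intro e he; simp only [Finset.mem_union]; tauto

lemma Loc.cut_iff (L : Loc m s r p T B J jenum P) {S : Finset (ℕ × ι)} (hv : Valid m S)
    (hS : S.card + 2 < r) {q : ℕ} (hq : q ∈ Finset.Icc 1 s) {ℓ : ℕ} (h1 : 1 ≤ ℓ)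
    (h2 : ℓ ≤ (J q).card) {i : ℕ} (hi : i ∈ Finset.Icc 1 m)
    (hp : 0 < P (insert (i, jenum q ℓ) S)) {h n : ℕ} (hc : Cut1 m J jenum S h q n) :
    i ≤ h ↔ ℓ ≤ n := by
  have hcard := card_ins (i, jenum q ℓ) S
  have hv' := hv.insert hi (jenum q ℓ)
  obtain ⟨c1, c2, c3⟩ := hc
  constructor
  · intro hle
    by_contra! hlt
    rcases c3 with c3 | ⟨a, ha, hha, haS⟩
    · omega
    · have := L.order hv' (by omega) hp hq (by omega : 1 ≤ n + 1) hlt h2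
        (Finset.mem_insert_of_mem haS) (Finset.mem_insert_self _ _)
      omega
  · intro hle
    rcases c2 with c2 | ⟨a, ha, hha, haS⟩
    · omega
    · have := L.order hv' (by omega) hp hq h1 hle c1
        (Finset.mem_insert_self _ _) (Finset.mem_insert_of_mem haS)
      omega

lemma Loc.forced (L : Loc m s r p T B J jenum P) {S : Finset (ℕ × ι)}
    (hS : S.card < r) {k : ℕ} (hk : k ∈ Finset.Icc 1 m) {j : ι} {t : ℕ}
    (hf : ∀ i ∈ Finset.Icc 1 m, 0 < P (insert (i, j) S) → (i = k ↔ t = k)) :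
    P (insert (k, j) S) = (if t = k then 1 else 0) * P S := by
  have hz : ∀ i ∈ Finset.Icc 1 m, ¬ 0 < P (insert (i, j) S) → P (insert (i, j) S) = 0 :=
    fun i _ h => le_antisymm (not_lt.1 h) (L.nn _ ((card_ins _ _).trans hS))
  split_ifs with ht
  · rw [one_mul, ← L.asg S hS j]
    symm
    refine Finset.sum_eq_single k (fun i hi hne => ?_) (fun h => absurd hk h)
    exact hz i hi fun h => hne ((hf i hi h).2 ht)
  · rw [zero_mul]
    exact hz k hk fun h => ht ((hf k hk h).1 rfl)

lemma Loc.long_sol (L : Loc m s r p T B J jenum P) (hr : 6 * s + 10 ≤ r) (hp : ∀ j, 0 < p j)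
    (hdisj : ∀ q ∈ Finset.Icc 1 s, ∀ q' ∈ Finset.Icc 1 s, ∀ j, j ∈ J q → j ∈ J q' → q = q')
    (henum : ∀ q ∈ Finset.Icc 1 s, Set.BijOn (jenum q) (Set.Icc 1 (J q).card) ↑(J q))
    {K : Finset (ℕ × ι)} (hvK : Valid m K) (hcK : K.card ≤ 1) (hpK : 0 < P K) :
    ∃ σ : ι → ℕ, (∀ q ∈ Finset.Icc 1 s, ∀ j ∈ J q, σ j ∈ Finset.Icc 1 m) ∧
      (∀ q ∈ Finset.Icc 1 s, ∀ j ∈ J q, 0 < P (insert (σ j, j) K)) ∧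
      (∀ i ∈ Finset.Icc 1 m,
        ∑ j ∈ Finset.univ.filter (fun j => (∃ q ∈ Finset.Icc 1 s, j ∈ J q) ∧ σ j = i), p j ≤ T) ∧
      (∀ i ∈ Finset.Icc 1 (m - 1), 0 ≤ ∑ q ∈ Finset.Icc 1 s, (B : ℤ) ^ (s - q) *
        ∑ j ∈ J q, ((if σ j = i then 1 else 0 : ℤ) - (if σ j = i + 1 then 1 else 0 : ℤ))) ∧
      (∀ q ∈ Finset.Icc 1 s, ∀ ℓ ∈ Finset.Icc 1 ((J q).card - 1),
        σ (jenum q ℓ) ≤ σ (jenum q (ℓ + 1))) := by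
  obtain ⟨n, S, hn⟩ := L.chain hr hvK hcK hpK
  have hmono : ∀ q ∈ Finset.Icc 1 s, Monotone (fun h => n h q) := by
    intro q hq
    refine monotone_nat_of_le_succ fun h => ?_
    obtain ⟨-, hv, hc, hpos, hcut⟩ := hn h
    obtain ⟨c1, c2, -⟩ := hcut q hq
    rcases Nat.eq_zero_or_pos (n h q) with h0 | h0
    · simp [h0]
    · obtain ⟨i, hi, hpi⟩ := L.ext (by omega) hpos (jenum q (n h q))
      have e1 := L.cut_iff hv (by omega) hq h0 c1.1 hi hpi c1
      have e2 := L.cut_iff hv (by omega) hq h0 c1.1 hi hpi c2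
      have := e1.2 le_rfl
      exact e2.1 (by omega)
  have hn0 : ∀ q ∈ Finset.Icc 1 s, n 0 q = 0 := by
    intro q hq
    obtain ⟨-, -, -, -, hcut⟩ := hn 0
    rcases (hcut q hq).1.2.1 with h | ⟨i, hi, hi0, -⟩
    · exact h
    · rw [Finset.mem_Icc] at hi; omega
  have hnm : ∀ q ∈ Finset.Icc 1 s, n m q = (J q).card := by
    intro q hq
    obtain ⟨-, -, -, -, hcut⟩ := hn m
    rcases (hcut q hq).1.2.2 with h | ⟨i, hi, hi0, -⟩
    · exact h
    · rw [Finset.mem_Icc] at hi; omega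
  obtain ⟨σ, hσ⟩ : ∃ σ : ι → ℕ, ∀ q ∈ Finset.Icc 1 s, ∀ ℓ, 1 ≤ ℓ → ℓ ≤ (J q).card →
      ∀ h, σ (jenum q ℓ) ≤ h ↔ ℓ ≤ n h q := by
    have : ∀ j : ι, ∃ t : ℕ, ∀ q ∈ Finset.Icc 1 s, ∀ ℓ, 1 ≤ ℓ → ℓ ≤ (J q).card →
        jenum q ℓ = j → ∀ h, t ≤ h ↔ ℓ ≤ n h q := by
      intro j
      by_cases hj : ∃ q ∈ Finset.Icc 1 s, ∃ ℓ, 1 ≤ ℓ ∧ ℓ ≤ (J q).card ∧ jenum q ℓ = j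
      · obtain ⟨q, hq, ℓ, h1, h2, rfl⟩ := hj
        have hex : ∃ h, ℓ ≤ n h q := ⟨m, by rw [hnm q hq]; exact h2⟩
        refine ⟨Nat.find hex, ?_⟩
        intro q' hq' ℓ' h1' h2' he h
        have hm := (henum q hq).mapsTo (show ℓ ∈ Set.Icc 1 (J q).card from ⟨h1, h2⟩)
        have hm' := (henum q' hq').mapsTo (show ℓ' ∈ Set.Icc 1 (J q').card from ⟨h1', h2'⟩)
        rw [he] at hm'
        obtain rfl := hdisj q hq q' hq' _ hm hm'
        obtain rfl := (henum q hq).injOn (show ℓ' ∈ Set.Icc 1 (J q).card from ⟨h1', h2'⟩)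
          (show ℓ ∈ Set.Icc 1 (J q).card from ⟨h1, h2⟩) he
        constructor
        · intro hle
          exact (Nat.find_spec hex).trans (hmono q hq hle)
        · intro hle
          exact Nat.find_min' hex hle
      · refine ⟨0, fun q hq ℓ h1 h2 he => absurd ⟨q, hq, ℓ, h1, h2, he⟩ hj⟩
    choose σ hσ using this
    exact ⟨σ, fun q hq ℓ h1 h2 => hσ _ q hq ℓ h1 h2 rfl⟩
  have hidx : ∀ q ∈ Finset.Icc 1 s, ∀ j ∈ J q, ∃ ℓ, 1 ≤ ℓ ∧ ℓ ≤ (J q).card ∧ jenum q ℓ = j := by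
    intro q hq j hj
    obtain ⟨ℓ, hℓ, he⟩ := (henum q hq).surjOn (Finset.mem_coe.2 hj)
    exact ⟨ℓ, hℓ.1, hℓ.2, he⟩
  have hA : ∀ q ∈ Finset.Icc 1 s, ∀ j ∈ J q, σ j ∈ Finset.Icc 1 m := by
    intro q hq j hj
    obtain ⟨ℓ, h1, h2, rfl⟩ := hidx q hq j hj
    have a := hσ q hq ℓ h1 h2 0
    have b := hσ q hq ℓ h1 h2 m
    rw [hn0 q hq] at a
    rw [hnm q hq] at b
    have := b.2 h2
    rw [Finset.mem_Icc]; omega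
  -- values of the functional on the pieces
  have hval : ∀ q ∈ Finset.Icc 1 s, ∀ j ∈ J q, ∀ k, k + 1 ∈ Finset.Icc 1 m → ∀ h,
      Cut1 m J jenum (S h) k q (n k q) → Cut1 m J jenum (S h) (k + 1) q (n (k + 1) q) →
      P (insert (k + 1, j) (S h)) = (if σ j = k + 1 then 1 else 0) * P (S h) := by
    intro q hq j hj k hk h c1 c2
    obtain ⟨ℓ, h1, h2, rfl⟩ := hidx q hq j hj
    obtain ⟨-, hv, hc, hpos, -⟩ := hn h
    refine L.forced (by omega) hk fun i hi hpi => ?_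
    have e1 := L.cut_iff hv (by omega) hq h1 h2 hi hpi c1
    have e2 := L.cut_iff hv (by omega) hq h1 h2 hi hpi c2
    rw [← hσ q hq ℓ h1 h2] at e1 e2
    omega
  refine ⟨σ, hA, ?_, ?_, ?_, ?_⟩
  · intro q hq j hj
    have hs := hA q hq j hj
    obtain ⟨k, hk⟩ : ∃ k, σ j = k + 1 := ⟨σ j - 1, by rw [Finset.mem_Icc] at hs; omega⟩
    obtain ⟨hK, hv, hc, hpos, hcut⟩ := hn k
    have hvv := hval q hq j hj k (hk ▸ hs) k (hcut q hq).1 (hcut q hq).2.1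
    rw [if_pos hk, one_mul] at hvv
    have hcc := card_ins (k + 1, j) (S k)
    rw [hk]
    refine L.pos_subset (hv.insert (hk ▸ hs) j) (by omega) (Finset.insert_subset_insert _ hK) ?_
    rw [hvv]; exact hpos
  · intro i hi
    obtain ⟨k, rfl⟩ : ∃ k, i = k + 1 := ⟨i - 1, by rw [Finset.mem_Icc] at hi; omega⟩
    obtain ⟨hK, hv, hc, hpos, hcut⟩ := hn k
    have hl := L.load (S k) (by omega) _ hi
    have : ∑ j ∈ Finset.univ.filter
        (fun j => (∃ q ∈ Finset.Icc 1 s, j ∈ J q) ∧ σ j = k + 1), p j * P (S k) ≤ T * P (S k) := by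
      refine le_trans ?_ hl
      refine le_trans (Finset.sum_le_sum (g := fun j => p j * P (insert (k + 1, j) (S k)))
        fun j hj => ?_) (Finset.sum_le_sum_of_subset_of_nonneg (Finset.subset_univ _)
          fun j _ _ => mul_nonneg (hp j).le (L.nn _ ?_))
      · simp only [Finset.mem_filter] at hj
        obtain ⟨-, ⟨q, hq, hjq⟩, hσj⟩ := hj
        rw [hval q hq j hjq k hi k (hcut q hq).1 (hcut q hq).2.1, if_pos hσj, one_mul]
      · have := card_ins (k + 1, j) (S k); omega
    rw [← Finset.sum_mul] at this
    exact le_of_mul_le_mul_right this hpos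
  · intro i hi
    obtain ⟨k, rfl⟩ : ∃ k, i = k + 1 := ⟨i - 1, by rw [Finset.mem_Icc] at hi; omega⟩
    obtain ⟨hK, hv, hc, hpos, hcut⟩ := hn k
    have hl := L.sym (S k) (by omega) _ hi
    have hk1 : k + 1 ∈ Finset.Icc 1 m := by rw [Finset.mem_Icc] at *; omega
    have hk2 : k + 1 + 1 ∈ Finset.Icc 1 m := by rw [Finset.mem_Icc] at *; omega
    have heq : ∑ q ∈ Finset.Icc 1 s, (B : ℝ) ^ (s - q) *
        ∑ j ∈ J q, (P (insert (k + 1, j) (S k)) - P (insert (k + 1 + 1, j) (S k))) =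
        ((∑ q ∈ Finset.Icc 1 s, (B : ℤ) ^ (s - q) * ∑ j ∈ J q,
          ((if σ j = k + 1 then 1 else 0 : ℤ) - (if σ j = k + 1 + 1 then 1 else 0 : ℤ)) : ℤ) : ℝ)
          * P (S k) := by
      push_cast
      rw [Finset.sum_mul]
      refine Finset.sum_congr rfl fun q hq => ?_
      rw [mul_assoc, Finset.sum_mul]
      congr 1
      refine Finset.sum_congr rfl fun j hj => ?_
      obtain ⟨c1, c2, c3⟩ := hcut q hq
      rw [hval q hq j hj k hk1 k c1 c2, hval q hq j hj (k + 1) hk2 k c2 c3, sub_mul]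
    rw [heq] at hl
    have := nonneg_of_mul_nonneg_left hl hpos
    exact_mod_cast this
  · intro q hq ℓ hℓ
    rw [Finset.mem_Icc] at hℓ
    rw [hσ q hq ℓ hℓ.1 (by omega)]
    have := (hσ q hq (ℓ + 1) (by omega) (by omega) _).1 le_rfl
    omega

end locsec2

section finalsec

set_option linter.unusedSectionVars false

variable {ι : Type*} [Fintype ι] {m s r : ℕ} {p : ι → ℝ} {T : ℝ} {B : ℕ}
  {J : ℕ → Finset ι} {jenum : ℕ → ℕ → ι} {P : Finset (ℕ × ι) → ℝ}

lemma Loc.total (L : Loc m s r p T B J jenum P) (hr : 10 ≤ r) : ∑ j, p j ≤ m * T := by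
  have h1 : ∀ i ∈ Finset.Icc 1 m, ∑ j, p j * P (insert (i, j) ∅) ≤ T := by
    intro i hi
    have := L.load ∅ (by simp; omega) i hi
    rwa [L.one, mul_one] at this
  have h2 := Finset.sum_le_sum h1
  rw [Finset.sum_comm] at h2
  simp only [← Finset.mul_sum] at h2
  rw [Finset.sum_congr rfl (fun j _ => by rw [L.asg ∅ (by simp; omega) j, L.one, mul_one])] at h2
  simpa using h2

lemma Loc.le_T (L : Loc m s r p T B J jenum P) (hr : 10 ≤ r) (hp : ∀ j, 0 < p j) (j : ι) :
    p j ≤ T := by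
  obtain ⟨i, hi, hpos⟩ := L.ext (S := ∅) (by simp; omega) (by rw [L.one]; exact one_pos) j
  have hl := L.load (insert (i, j) ∅) (by have := card_ins (i, j) ∅; simp at this ⊢; omega) i hi
  have : p j * P (insert (i, j) (insert (i, j) ∅)) ≤
      ∑ j', p j' * P (insert (i, j') (insert (i, j) ∅)) :=
    Finset.single_le_sum (f := fun j' => p j' * P (insert (i, j') (insert (i, j) ∅)))
      (fun j' _ => mul_nonneg (hp j').le (L.nn _ (by
        have h1 := card_ins (i, j') (insert (i, j) ∅)
        have h2 := card_ins (i, j) ∅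
        rw [Finset.card_empty] at h2
        omega))) (Finset.mem_univ j)
  rw [Finset.insert_idem] at this
  exact le_of_mul_le_mul_right (this.trans hl) hpos

lemma Loc.exists_K (L : Loc m s r p T B J jenum P) (hr : 10 ≤ r) (hp : ∀ j, 0 < p j) (hT : 0 < T)
    (hB : 1 ≤ B) (hJ : ∀ q ∈ Finset.Icc 1 s, ∀ j ∈ J q, p j < T) (k : ℕ)
    (hk : (Finset.univ.filter fun j => p j = T).card = k) (hkm : k ≤ m) :
    ∃ K, Valid m K ∧ K.card ≤ 1 ∧ 0 < P K ∧ ∀ i ∈ Finset.Icc 1 m, m - k < i →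
      ∀ q ∈ Finset.Icc 1 s, ∀ j ∈ J q, ¬ 0 < P (insert (i, j) K) := by
  rcases Nat.eq_zero_or_pos k with hk0 | hk0
  · refine ⟨∅, by intro e he; simp at he, by simp, by rw [L.one]; exact one_pos, ?_⟩
    intro i hi hlt
    rw [Finset.mem_Icc] at hi; omega
  have hnn : ∀ e : ℕ × ι, 0 ≤ P (insert e ∅) := fun e => L.nn _ (by
    have h2 := card_ins e ∅
    rw [Finset.card_empty] at h2
    omega)
  obtain ⟨i0, hi0, hik, j0, hj0, hpos⟩ : ∃ i0 ∈ Finset.Icc 1 m, i0 ≤ m - k + 1 ∧ ∃ j0, p j0 = T ∧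
      0 < P (insert (i0, j0) ∅) := by
    by_contra! hcon
    have h1 : ∀ i ∈ Finset.Icc 1 m, ∑ j ∈ Finset.univ.filter (fun j => p j = T),
        T * P (insert (i, j) ∅) ≤ if m - k + 1 < i then T else 0 := by
      intro i hi
      split_ifs with hlt
      · have := L.load ∅ (by simp; omega) i hi
        rw [L.one, mul_one] at this
        refine le_trans ?_ this
        refine le_trans (Finset.sum_le_sum (g := fun j => p j * P (insert (i, j) ∅)) ?_)
          (Finset.sum_le_sum_of_subset_of_nonneg (Finset.subset_univ _)
            fun j _ _ => mul_nonneg (hp j).le (hnn _))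
        intro j hj
        rw [(Finset.mem_filter.1 hj).2]
      · refine Finset.sum_nonpos fun j hj => ?_
        exact mul_nonpos_of_nonneg_of_nonpos hT.le
          (hcon i hi (by omega) j (Finset.mem_filter.1 hj).2)
    have h2 := Finset.sum_le_sum h1
    rw [Finset.sum_comm] at h2
    simp only [← Finset.mul_sum] at h2
    rw [Finset.sum_congr rfl (fun j _ => by rw [L.asg ∅ (by simp; omega) j, L.one]),
      Finset.sum_const, ← Finset.sum_filter, Finset.sum_const, hk, nsmul_eq_mul, nsmul_eq_mul,
      mul_one, mul_comm] at h2
    have h3 := le_of_mul_le_mul_right h2 hT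
    have h4 : (Finset.filter (fun i => m - k + 1 < i) (Finset.Icc 1 m)) ⊆
        Finset.Icc (m - k + 2) m := by
      intro i hi
      rw [Finset.mem_filter, Finset.mem_Icc] at hi
      rw [Finset.mem_Icc]; omega
    have h5 := Finset.card_le_card h4
    rw [Nat.card_Icc] at h5
    have h6 : k ≤ (Finset.filter (fun i => m - k + 1 < i) (Finset.Icc 1 m)).card := by
      exact_mod_cast h3
    omega
  have hcK : (insert (i0, j0) ∅ : Finset (ℕ × ι)).card ≤ 1 := by
    have h2 := card_ins (i0, j0) ∅
    rwa [Finset.card_empty] at h2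
  have hvK : Valid m (insert (i0, j0) ∅ : Finset (ℕ × ι)) :=
    Valid.insert (by intro e he; simp at he) hi0 j0
  generalize hKK : (insert (i0, j0) ∅ : Finset (ℕ × ι)) = K at hcK hvK hpos
  have hnK : ∀ e, 0 ≤ P (insert e K) := fun e => L.nn _ (by
    have h2 := card_ins e K
    omega)
  refine ⟨K, hvK, hcK, hpos, ?_⟩
  have hind : ∀ d, i0 + d ≤ m → ∀ q ∈ Finset.Icc 1 s, ∀ j ∈ J q, P (insert (i0 + d, j) K) = 0 := by
    intro d
    induction d with
    | zero =>
      intro _ q hq j hj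
      have hne : j ≠ j0 := by
        rintro rfl
        have := hJ q hq j hj
        linarith
      have hl := L.load K (by omega) i0 hi0
      have h1 : ∑ j' ∈ {j, j0}, p j' * P (insert (i0, j') K) ≤ ∑ j', p j' * P (insert (i0, j') K) :=
        Finset.sum_le_sum_of_subset_of_nonneg (Finset.subset_univ _)
          fun j _ _ => mul_nonneg (hp j).le (hnK _)
      rw [Finset.sum_pair hne, hj0] at h1
      have h2 : insert (i0, j0) K = K := by
        rw [← hKK, Finset.insert_idem]
      rw [h2] at h1
      have h3 := hnK (i0, j)
      have h4 : p j * P (insert (i0, j) K) ≤ 0 := by linarith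
      rw [add_zero]
      exact le_antisymm (nonpos_of_mul_nonpos_right h4 (hp j)) h3
    | succ d ih =>
      intro hd q hq j hj
      have hd' : i0 + d ∈ Finset.Icc 1 (m - 1) := by
        rw [Finset.mem_Icc] at *; omega
      have hl := L.sym K (by omega) _ hd'
      have h1 : ∑ q ∈ Finset.Icc 1 s, (B : ℝ) ^ (s - q) *
          ∑ j ∈ J q, P (insert (i0 + d + 1, j) K) ≤ 0 := by
        have : ∑ q ∈ Finset.Icc 1 s, (B : ℝ) ^ (s - q) *
          ∑ j ∈ J q, (P (insert (i0 + d, j) K) - P (insert (i0 + d + 1, j) K)) =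
          - ∑ q ∈ Finset.Icc 1 s, (B : ℝ) ^ (s - q) *
          ∑ j ∈ J q, P (insert (i0 + d + 1, j) K) := by
          rw [← Finset.sum_neg_distrib]
          refine Finset.sum_congr rfl fun q hq => ?_
          rw [← mul_neg, ← Finset.sum_neg_distrib]
          congr 1
          refine Finset.sum_congr rfl fun j hj => ?_
          rw [ih (by omega) q hq j hj, zero_sub]
        linarith
      have hBp : ∀ q, (0 : ℝ) < (B : ℝ) ^ (s - q) := fun q =>
        pow_pos (by exact_mod_cast hB) _
      have h2 : (B : ℝ) ^ (s - q) * ∑ j ∈ J q, P (insert (i0 + d + 1, j) K) ≤ 0 :=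
        le_trans (Finset.single_le_sum (f := fun q => (B : ℝ) ^ (s - q) *
          ∑ j ∈ J q, P (insert (i0 + d + 1, j) K)) (fun q _ => mul_nonneg (hBp q).le
            (Finset.sum_nonneg fun j _ => hnK _)) hq) h1
      have h3 := nonpos_of_mul_nonpos_right h2 (hBp q)
      have h4 : P (insert (i0 + d + 1, j) K) ≤ 0 :=
        le_trans (Finset.single_le_sum (f := fun j => P (insert (i0 + d + 1, j) K))
          (fun j _ => hnK _) hj) h3
      exact le_antisymm h4 (hnK _)
  intro i hi hlt q hq j hj
  obtain ⟨d, rfl⟩ := Nat.exists_eq_add_of_le (show i0 ≤ i by omega)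
  rw [hind d (Finset.mem_Icc.1 hi).2 q hq j hj]
  exact lt_irrefl _

lemma greedy {ε : ℝ} (hp : ∀ j, 0 < p j) (htot : ∑ j, p j ≤ m * T)
    (A : Finset ι) (σ0 : ι → ℕ) (hA : ∀ j ∈ A, σ0 j ∈ Finset.Icc 1 m)
    (hload : ∀ i ∈ Finset.Icc 1 m, ∑ j ∈ A.filter (fun j => σ0 j = i), p j ≤ (1 + ε) * T)
    (hsmall : ∀ j, j ∉ A → p j ≤ ε * T) :
    ∃ σ : ι → ℕ, (∀ j ∈ A, σ j = σ0 j) ∧ (∀ j, σ j ∈ Finset.Icc 1 m) ∧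
      ∀ i ∈ Finset.Icc 1 m,
        ∑ j ∈ Finset.univ.filter (fun j => σ j = i), p j ≤ (1 + ε) * T := by
  have key : ∀ U : Finset ι, ∃ σ : ι → ℕ, (∀ j ∈ A, σ j = σ0 j) ∧
      (∀ j ∈ A ∪ U, σ j ∈ Finset.Icc 1 m) ∧
      ∀ i ∈ Finset.Icc 1 m, ∑ j ∈ (A ∪ U).filter (fun j => σ j = i), p j ≤ (1 + ε) * T := by
    intro U
    induction U using Finset.induction_on with
    | empty => exact ⟨σ0, fun _ _ => rfl, by simpa using hA, by simpa using hload⟩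
    | insert j U hj ih =>
      obtain ⟨σ, h1, h2, h3⟩ := ih
      by_cases hjA : j ∈ A ∪ U
      · rw [Finset.union_insert, Finset.insert_eq_of_mem hjA]
        exact ⟨σ, h1, h2, h3⟩
      rw [Finset.union_insert]
      have hjA' : j ∉ A := fun h => hjA (Finset.mem_union_left _ h)
      have hm : (Finset.Icc 1 m).Nonempty := by
        rw [Finset.nonempty_Icc]
        by_contra! h0
        have : m = 0 := by omega
        rw [this, Nat.cast_zero, zero_mul] at htot
        have := Finset.sum_pos (fun j _ => hp j) ⟨j, Finset.mem_univ j⟩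
        linarith
      obtain ⟨i, hi, hle⟩ : ∃ i ∈ Finset.Icc 1 m,
          ∑ j ∈ (A ∪ U).filter (fun j => σ j = i), p j ≤ T := by
        refine Finset.exists_le_of_sum_le hm ?_
        rw [Finset.sum_fiberwise_of_maps_to h2]
        refine le_trans (Finset.sum_le_sum_of_subset_of_nonneg (Finset.subset_univ _)
          fun j _ _ => (hp j).le) ?_
        simpa using htot
      refine ⟨Function.update σ j i, ?_, ?_, ?_⟩
      · intro j' hj'
        rw [Function.update_of_ne (by rintro rfl; exact hjA' hj'), h1 j' hj']
      · intro j' hj'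
        rcases Finset.mem_insert.1 hj' with rfl | hj''
        · rwa [Function.update_self]
        · rw [Function.update_of_ne (by rintro rfl; exact hjA hj'')]
          exact h2 j' hj''
      · intro i' hi'
        have hfe : (A ∪ U).filter (fun j' => Function.update σ j i j' = i') =
            (A ∪ U).filter (fun j' => σ j' = i') := by
          refine Finset.filter_congr fun j' hj' => ?_
          rw [Function.update_of_ne (by rintro rfl; exact hjA hj')]
        rw [Finset.filter_insert, Function.update_self, hfe]
        split_ifs with hii
        · rw [Finset.sum_insert (fun h => hjA (Finset.mem_filter.1 h).1)]
          subst hii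
          have := hsmall j hjA'
          linarith
        · exact h3 i' hi'
  obtain ⟨σ, h1, h2, h3⟩ := key Finset.univ
  rw [Finset.union_eq_right.2 (Finset.subset_univ A)] at h2 h3
  exact ⟨σ, h1, fun j => h2 j (Finset.mem_univ j), h3⟩

end finalsec

lemma jq_disj {ι : Type*} [Fintype ι] {p : ι → ℝ} {ε T : ℝ} (hε : 0 < ε) (hT : 0 < T) {q q' : ℕ}
    {j : ι} (h : j ∈ Jq p ε T q) (h' : j ∈ Jq p ε T q') : q ≤ q' := by
  simp only [Jq, Finset.mem_filter] at h h'
  have hpos : 0 < ε ^ 2 * T := by positivity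
  have h1 := h.2.1.trans_lt h'.2.2
  rw [mul_assoc, mul_assoc] at h1
  have h2 := lt_of_mul_lt_mul_right h1 hpos.le
  have h3 : (q : ℝ) < (q' : ℝ) + 1 := by linarith
  have h4 : q < q' + 1 := by exact_mod_cast h3
  omega

lemma jq_cover {ι : Type*} [Fintype ι] {p : ι → ℝ} {ε T : ℝ} (hε : 0 < ε) (hT : 0 < T) {s : ℕ}
    (hs : (s : ℝ) = (1 - ε) / ε ^ 2) {j : ι} (h1 : ε * T ≤ p j) (h2 : p j < T) :
    ∃ q ∈ Finset.Icc 1 s, j ∈ Jq p ε T q := by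
  have hpos : 0 < ε ^ 2 * T := by positivity
  have e1 : 1 / ε * (ε ^ 2 * T) = ε * T := by field_simp
  have e2 : (1 / ε + s) * (ε ^ 2 * T) = T := by rw [hs]; field_simp; ring
  set y := p j / (ε ^ 2 * T) - 1 / ε with hy
  have hpy : p j = (1 / ε + y) * (ε ^ 2 * T) := by
    rw [hy]; field_simp; ring
  have hy0 : 0 ≤ y := by
    have : 1 / ε * (ε ^ 2 * T) ≤ (1 / ε + y) * (ε ^ 2 * T) := by rw [e1, ← hpy]; exact h1
    have := le_of_mul_le_mul_right this hpos
    linarith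
  have hys : y < s := by
    have : (1 / ε + y) * (ε ^ 2 * T) < (1 / ε + s) * (ε ^ 2 * T) := by rw [e2, ← hpy]; exact h2
    have := lt_of_mul_lt_mul_right this hpos.le
    linarith
  have hf := Nat.floor_le hy0
  have hf' := Nat.lt_floor_add_one y
  have hfs : ⌊y⌋₊ < s := by
    have : (⌊y⌋₊ : ℝ) < s := hf.trans_lt hys
    exact_mod_cast this
  refine ⟨⌊y⌋₊ + 1, Finset.mem_Icc.2 ⟨by omega, by omega⟩, ?_⟩
  simp only [Jq, Finset.mem_filter, Finset.mem_univ, true_and]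
  rw [mul_assoc, mul_assoc, hpy]
  push_cast
  constructor
  · exact mul_le_mul_of_nonneg_right (by linarith) hpos.le
  · exact mul_lt_mul_of_pos_right (by linarith) hpos

lemma jq_lt {ι : Type*} [Fintype ι] {p : ι → ℝ} {ε T : ℝ} (hε : 0 < ε) (hT : 0 < T) {s : ℕ}
    (hs : (s : ℝ) = (1 - ε) / ε ^ 2) {q : ℕ} (hq : q ∈ Finset.Icc 1 s) {j : ι}
    (hj : j ∈ Jq p ε T q) : p j < T := by
  have hpos : 0 < ε ^ 2 * T := by positivity
  have e2 : (1 / ε + s) * (ε ^ 2 * T) = T := by rw [hs]; field_simp; ring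
  simp only [Jq, Finset.mem_filter] at hj
  refine hj.2.2.trans_le ?_
  rw [mul_assoc]
  calc _ ≤ (1 / ε + s) * (ε ^ 2 * T) := by
        have : (q : ℝ) ≤ s := by exact_mod_cast (Finset.mem_Icc.1 hq).2
        exact mul_le_mul_of_nonneg_right (by linarith) hpos.le
    _ = T := e2

lemma degree_bound {ε : ℝ} {s r : ℕ} (hε0 : 0 < ε) (hε1 : ε < 1) (hεint : ∃ t : ℤ, ε * (t : ℝ) = 1)
    (hs : (s : ℝ) = (1 - ε) / ε ^ 2) (hr : 4 / ε ^ 5 ≤ (r : ℝ)) : 6 * s + 10 ≤ r := by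
  obtain ⟨t, ht⟩ := hεint
  have hε : ε = 1 / (t : ℝ) := by
    have : (t : ℝ) ≠ 0 := by rintro h; rw [h] at ht; simp at ht
    field_simp; exact ht
  have ht1 : (1 : ℝ) < t := by
    by_contra! h
    have : ε * (t : ℝ) ≤ ε * 1 := mul_le_mul_of_nonneg_left h hε0.le
    linarith
  have ht2 : (2 : ℝ) ≤ t := by
    have : (1 : ℤ) < t := by exact_mod_cast ht1
    exact_mod_cast (by omega : (2 : ℤ) ≤ t)
  have ht0 : (t : ℝ) ≠ 0 := by linarith
  generalize (t : ℝ) = u at *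
  subst hε
  have e1 : (s : ℝ) = u ^ 2 - u := by rw [hs]; field_simp
  have e2 : 4 / (1 / u) ^ 5 = 4 * u ^ 5 := by field_simp
  rw [e2] at hr
  have h8 : (8 : ℝ) ≤ u ^ 3 := by
    calc (8 : ℝ) = 2 ^ 3 := by norm_num
      _ ≤ u ^ 3 := pow_le_pow_left₀ (by norm_num) ht2 3
  have h4 : (4 : ℝ) ≤ u ^ 2 := by nlinarith
  have h5 : 8 * u ^ 2 ≤ u ^ 5 := by
    have := mul_le_mul_of_nonneg_right h8 (sq_nonneg u)
    calc 8 * u ^ 2 ≤ u ^ 3 * u ^ 2 := this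
      _ = u ^ 5 := by ring
  have : (6 * s + 10 : ℝ) ≤ r := by rw [e1]; nlinarith
  exact_mod_cast this

/-- If `order(B,T)` admits a degree-`r` SA pseudoexpectation with `r ≥ 4/ε⁵`, then
`order(B,(1+ε)T)` has an integral solution; in particular there is an assignment of
makespan at most `(1+ε)T`. -/
theorem sa_pseudoexpectation_order_gives_integral_solution {ι : Type*} [Fintype ι]
    (m s : ℕ) (ε T : ℝ) (p : ι → ℝ)
    (hp : ∀ j, 0 < p j) (hT : 0 < T)
    (hε0 : 0 < ε) (hε1 : ε < 1) (hεint : ∃ t : ℤ, ε * (t : ℝ) = 1)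
    (hs : (s : ℝ) = (1 - ε) / ε ^ 2)
    (B : ℕ) (hB : B = 1 + 2 * s * ((Finset.Icc 1 s).sup fun q => (Jq p ε T q).card))
    (jenum : ℕ → ℕ → ι)
    (henum : ∀ q ∈ Finset.Icc 1 s,
      Set.BijOn (jenum q) (Set.Icc 1 (Jq p ε T q).card) ↑(Jq p ε T q))
    (r : ℕ) (hr : 4 / ε ^ 5 ≤ (r : ℝ))
    (hpe : ∃ PE : CubeQuot (ℕ × ι) →ₗ[ℝ] ℝ,
      IsSAPseudo (orderIneqs m s p ε T B jenum) (assignEqs m ι) r PE) :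
    (∃ x : ℕ → ι → ℕ, (∀ i j, x i j ≤ 1) ∧
      (∀ j : ι, ∑ i ∈ Finset.Icc 1 m, x i j = 1) ∧
      (∀ i ∈ Finset.Icc 1 m, ∑ j : ι, (x i j : ℝ) * p j ≤ (1 + ε) * T) ∧
      (∀ i ∈ Finset.Icc 1 (m - 1),
        0 ≤ ∑ q ∈ Finset.Icc 1 s,
              (B : ℤ) ^ (s - q) * ∑ j ∈ Jq p ε T q, ((x i j : ℤ) - (x (i + 1) j : ℤ))) ∧
      (∀ q ∈ Finset.Icc 1 s, ∀ ℓ ∈ Finset.Icc 1 ((Jq p ε T q).card - 1),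
        ∀ h ∈ Finset.Icc 1 m,
          ∑ i ∈ Finset.Icc 1 h, x i (jenum q (ℓ + 1)) ≤
            ∑ i ∈ Finset.Icc 1 h, x i (jenum q ℓ))) ∧
    ∃ σ : ι → ℕ, (∀ j, σ j ∈ Finset.Icc 1 m) ∧
      ∀ i ∈ Finset.Icc 1 m,
        ∑ j ∈ Finset.univ.filter (fun j => σ j = i), p j ≤ (1 + ε) * T := by
  obtain ⟨PE, hPE⟩ := hpe
  have L := loc_of_SA hPE
  have hr' := degree_bound hε0 hε1 hεint hs hr
  have hr10 : 10 ≤ r := by omega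
  have hB1 : 1 ≤ B := by omega
  have htot := L.total hr10
  have hleT := L.le_T hr10 hp
  obtain ⟨k, hk⟩ : ∃ k, (Finset.univ.filter fun j => p j = T).card = k := ⟨_, rfl⟩
  have hkm : k ≤ m := by
    have h1 : ∑ j ∈ Finset.univ.filter (fun j => p j = T), p j ≤ m * T :=
      le_trans (Finset.sum_le_sum_of_subset_of_nonneg (Finset.subset_univ _)
        fun j _ _ => (hp j).le) htot
    rw [Finset.sum_congr rfl (fun j hj => (Finset.mem_filter.1 hj).2), Finset.sum_const, hk,
      nsmul_eq_mul] at h1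
    exact_mod_cast le_of_mul_le_mul_right h1 hT
  have hJlt : ∀ q ∈ Finset.Icc 1 s, ∀ j ∈ Jq p ε T q, p j < T := fun q hq j hj =>
    jq_lt hε0 hT hs hq hj
  obtain ⟨K, hvK, hcK, hpK, hK⟩ := L.exists_K hr10 hp hT hB1 hJlt k hk hkm
  obtain ⟨σL, a1, a2, a3, a4, a5⟩ := L.long_sol hr' hp
    (fun q _ q' _ j h h' => le_antisymm (jq_disj hε0 hT h h') (jq_disj hε0 hT h' h))
    henum hvK hcK hpK
  obtain ⟨e, he1, he2⟩ : ∃ e : ι → ℕ, (∀ j, p j = T → e j < k) ∧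
      ∀ j j', p j = T → p j' = T → e j = e j' → j = j' := by
    have eq := Finset.equivFinOfCardEq hk
    refine ⟨fun j => if h : p j = T then (eq ⟨j, by simp [h]⟩ : ℕ) else 0, ?_, ?_⟩
    · intro j hj
      simp only [hj, dite_true]
      exact Fin.is_lt _
    · intro j j' hj hj' h
      simp only [hj, hj', dite_true] at h
      have := eq.injective (Fin.ext h)
      exact congrArg Subtype.val this
  let σ0 : ι → ℕ := fun j => if p j = T then m - k + 1 + e j else σL j
  have hσ0T : ∀ j, p j = T → σ0 j = m - k + 1 + e j := fun j h => if_pos h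
  have hσ0L : ∀ j, p j ≠ T → σ0 j = σL j := fun j h => if_neg h
  obtain ⟨A, hAmem⟩ : ∃ A : Finset ι, ∀ j, j ∈ A ↔ (p j = T ∨ ∃ q ∈ Finset.Icc 1 s, j ∈ Jq p ε T q) :=
    ⟨Finset.univ.filter (fun j => p j = T ∨ ∃ q ∈ Finset.Icc 1 s, j ∈ Jq p ε T q),
      fun j => by simp only [Finset.mem_filter, Finset.mem_univ, true_and]⟩
  have hεT : T ≤ (1 + ε) * T := by nlinarith
  obtain ⟨σ, b1, b2, b3⟩ := greedy (ε := ε) hp htot A σ0 (by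
      intro j hj
      by_cases hjT : p j = T
      · rw [hσ0T j hjT, Finset.mem_Icc]
        have := he1 j hjT
        omega
      · rw [hσ0L j hjT]
        rcases (hAmem j).1 hj with h | ⟨q, hq, hjq⟩
        · exact absurd h hjT
        · exact a1 q hq j hjq) (by
      intro i hi
      refine le_trans ?_ hεT
      by_cases hik : m - k < i
      · have hall : ∀ j ∈ A.filter (fun j => σ0 j = i), p j = T := by
          intro j hj
          obtain ⟨hjA, hji⟩ := Finset.mem_filter.1 hj
          by_contra hjT
          rcases (hAmem j).1 hjA with h | ⟨q, hq, hjq⟩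
          · exact hjT h
          · rw [hσ0L j hjT] at hji
            exact hK i hi hik q hq j hjq (hji ▸ a2 q hq j hjq)
        have hcard : (A.filter (fun j => σ0 j = i)).card ≤ 1 := by
          refine Finset.card_le_one.2 fun j hj j' hj' => ?_
          have t1 := hall j hj
          have t2 := hall j' hj'
          have u1 := (Finset.mem_filter.1 hj).2
          have u2 := (Finset.mem_filter.1 hj').2
          rw [hσ0T _ t1] at u1
          rw [hσ0T _ t2] at u2
          exact he2 j j' t1 t2 (by omega)
        rw [Finset.sum_congr rfl hall, Finset.sum_const, nsmul_eq_mul]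
        have : ((A.filter (fun j => σ0 j = i)).card : ℝ) ≤ 1 := by exact_mod_cast hcard
        nlinarith
      · refine le_trans (Finset.sum_le_sum_of_subset_of_nonneg ?_ fun j _ _ => (hp j).le) (a3 i hi)
        intro j hj
        obtain ⟨hjA, hji⟩ := Finset.mem_filter.1 hj
        have hjT : p j ≠ T := by
          intro h
          rw [hσ0T j h] at hji
          omega
        rw [hσ0L j hjT] at hji
        simp only [Finset.mem_filter, Finset.mem_univ, true_and]
        exact ⟨((hAmem j).1 hjA).resolve_left hjT, hji⟩) (by
      intro j hj
      rw [hAmem] at hj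
      push Not at hj
      by_contra! hlt
      obtain ⟨q, hq, hjq⟩ := jq_cover hε0 hT hs hlt.le (lt_of_le_of_ne (hleT j) hj.1)
      exact hj.2 q hq hjq)
  have hσL : ∀ q ∈ Finset.Icc 1 s, ∀ j ∈ Jq p ε T q, σ j = σL j := by
    intro q hq j hj
    rw [b1 j ((hAmem j).2 (Or.inr ⟨q, hq, hj⟩)), hσ0L j (hJlt q hq j hj).ne]
  refine ⟨⟨fun i j => if σ j = i then 1 else 0, ?_, ?_, ?_, ?_, ?_⟩, σ, b2, b3⟩
  · intro i j
    dsimp only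
    split_ifs <;> simp
  · intro j
    rw [Finset.sum_ite_eq, if_pos (b2 j)]
  · intro i hi
    refine le_trans (le_of_eq ?_) (b3 i hi)
    rw [Finset.sum_filter]
    refine Finset.sum_congr rfl fun j _ => ?_
    dsimp only
    by_cases hji : σ j = i <;> simp [hji]
  · intro i hi
    refine (a4 i hi).trans_eq ?_
    refine Finset.sum_congr rfl fun q hq => ?_
    congr 1
    refine Finset.sum_congr rfl fun j hj => ?_
    dsimp only
    rw [hσL q hq j hj]
    push_cast
    rfl
  · intro q hq ℓ hℓ h hh
    have hmem : ∀ ℓ', 1 ≤ ℓ' → ℓ' ≤ (Jq p ε T q).card → jenum q ℓ' ∈ Jq p ε T q := fun ℓ' h1 h2 =>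
      (henum q hq).mapsTo (show ℓ' ∈ Set.Icc 1 (Jq p ε T q).card from ⟨h1, h2⟩)
    have hℓ' := Finset.mem_Icc.1 hℓ
    have h5 := a5 q hq ℓ hℓ
    rw [← hσL q hq _ (hmem ℓ (by omega) (by omega)),
      ← hσL q hq _ (hmem (ℓ + 1) (by omega) (by omega))] at h5
    rw [Finset.sum_ite_eq, Finset.sum_ite_eq]
    have g1 := Finset.mem_Icc.1 (b2 (jenum q ℓ))
    split_ifs with c1 c2
    · exact le_rfl
    · exfalso
      rw [Finset.mem_Icc] at c1 c2
      omega
    · simp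
    · exact le_rfl
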